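/- Evaluation of geometric switching policies via composed geometric horizon models (general rewards). Let a finite MDP with discount factor γ ∈ (0,1) and expected reward function r : X × A → ℝ be given. Fix a switching probability α ∈ (0,1], set β = γ(1-α), let ν = π₁ →α ⋯ →α πₙ be a geometric switching policy, and fix (x,a). Define a joint distribution over (X^{(1)},A^{(1)},…,X^{(n-1)},A^{(n-1)},X') by: (X^{(0)},A^{(0)}) = (x,a); for m = 1,…,n-1, X^{(m)} given (X^{(m-1)},A^{(m-1)}) has law μ^{π_m}_β(·|X^{(m-1)},A^{(m-1)}) and A^{(m)} given X^{(m)} has law π_{m+1}(·|X^{(m)}); and X' given (X^{(n-1)},A^{(n-1)}) has law μ^{πₙ}_γ(·|X^{(n-1)},A^{(n-1)}). Then Q^ν_γ(x,a) = r(x,a) + (γ/(1-γ)) [ ∑_{m=1}^{n-1} ((1-γ)/(1-β)) ((γ-β)/(1-β))^{m-1} E[ (1-α) r^{π_m}(X^{(m)}) + α r^{π_{m+1}}(X^{(m)}) ] + ((γ-β)/(1-β))^{n-1} E[r^{πₙ}(X')] ], where r^π(x) = ∑_{a} π(a|x) r(x,a) and all expectations are finite sums over the joint distribution. -/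

import Mathlib

open scoped BigOperators

/-- The state-action transition matrix `S^π((x,a),(x',a')) = P(x'|x,a) π(a'|x')`. -/
def stateActionMatrix {X A : Type} [Fintype X] [Fintype A]
    (P : X → A → X → ℝ) (π : X → A → ℝ) : Matrix (X × A) (X × A) ℝ :=
  Matrix.of fun p q => P p.1 p.2 q.1 * π q.1 q.2

/-- The discounted future state-visitation distribution
`μ^π_β(x'|x,a) = (1-β) ∑_{k≥0} β^k ∑_{a'} (S^π)^{k+1}((x,a),(x',a'))`. -/
noncomputable def visit {X A : Type} [Fintype X] [Fintype A] [DecidableEq X] [DecidableEq A]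
    (P : X → A → X → ℝ) (π : X → A → ℝ) (β : ℝ) (x : X) (a : A) (x' : X) : ℝ :=
  (1 - β) * ∑' k : ℕ, β ^ k * ∑ a' : A, (stateActionMatrix P π ^ (k + 1)) (x, a) (x', a')

/-- The law of `(X^{(m)}, A^{(m)})` in the composed-GHM sampling procedure for the
sequence of policies `πs 0, πs 1, …` (0-indexed, so `πs (m-1) = π_m`), started from
`(x,a) = (X^{(0)}, A^{(0)})`:  `X^{(m+1)} ∼ μ^{πs m}_β(·|X^{(m)},A^{(m)})` and
`A^{(m+1)} ∼ (πs (m+1))(·|X^{(m+1)})`. -/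
noncomputable def marginal {X A : Type} [Fintype X] [Fintype A] [DecidableEq X] [DecidableEq A]
    (P : X → A → X → ℝ) (β : ℝ) (πs : ℕ → X → A → ℝ) (x : X) (a : A) :
    ℕ → X × A → ℝ
  | 0 => fun q => if q = (x, a) then 1 else 0
  | m + 1 => fun q =>
      ∑ p : X × A,
        marginal P β πs x a m p * visit P (πs m) β p.1 p.2 q.1 * πs (m + 1) q.1 q.2

/-- `r^π(x) = ∑_a π(a|x) r(x,a)`. -/
def rewardUnder {X A : Type} [Fintype A] (r : X → A → ℝ) (π : X → A → ℝ) (x : X) : ℝ :=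
  ∑ a, π x a * r x a

theorem sam_mulVec {X A : Type} [Fintype X] [Fintype A]
    (P : X → A → X → ℝ) (π : X → A → ℝ) (f : X × A → ℝ) (x : X) (a : A) :
    (stateActionMatrix P π).mulVec f (x, a) = ∑ x', P x a x' * ∑ a', π x' a' * f (x', a') := by
  simp only [Matrix.mulVec, dotProduct, stateActionMatrix, Matrix.of_apply,
    Fintype.sum_prod_type, Finset.mul_sum, mul_assoc]

theorem sam_stoch {X A : Type} [Fintype X] [Fintype A] [DecidableEq X] [DecidableEq A]
    (P : X → A → X → ℝ) (hP0 : ∀ x a x', 0 ≤ P x a x') (hP1 : ∀ x a, ∑ x', P x a x' = 1)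
    (π : X → A → ℝ) (hπ0 : ∀ x a, 0 ≤ π x a) (hπ1 : ∀ x, ∑ a, π x a = 1) :
    stateActionMatrix P π ∈ Matrix.rowStochastic ℝ (X × A) := by
  rw [Matrix.mem_rowStochastic]
  refine ⟨fun p q => mul_nonneg (hP0 _ _ _) (hπ0 _ _), ?_⟩
  ext ⟨x, a⟩
  rw [sam_mulVec]
  simp [hπ1, hP1]

theorem visit_eq {X A : Type} [Fintype X] [Fintype A] [DecidableEq X] [DecidableEq A]
    (P : X → A → X → ℝ) (hP0 : ∀ x a x', 0 ≤ P x a x') (hP1 : ∀ x a, ∑ x', P x a x' = 1)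
    (π : X → A → ℝ) (hπ0 : ∀ x a, 0 ≤ π x a) (hπ1 : ∀ x, ∑ a, π x a = 1)
    (β : ℝ) (hβ0 : 0 ≤ β) (hβ1 : β < 1) (g : X → ℝ) (U : X → A → ℝ)
    (hU : ∀ x a, U x a = ∑ x', P x a x' * ((1 - β) * g x' + β * ∑ a', π x' a' * U x' a'))
    (x : X) (a : A) :
    U x a = ∑ z, visit P π β x a z * g z := by
  set S := stateActionMatrix P π with hS
  have hst : S ∈ Matrix.rowStochastic ℝ (X × A) := sam_stoch P hP0 hP1 π hπ0 hπ1
  have hle : ∀ k p q, 0 ≤ (S ^ k) p q ∧ (S ^ k) p q ≤ 1 := by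
    intro k p q
    have hk := pow_mem hst k
    exact ⟨Matrix.nonneg_of_mem_rowStochastic hk, Matrix.le_one_of_mem_rowStochastic hk⟩
  have hgeo := summable_geometric_of_lt_one hβ0 hβ1
  have hsum : ∀ p q, Summable fun k : ℕ => β ^ k * (S ^ (k + 1)) p q := by
    intro p q
    refine Summable.of_nonneg_of_le (fun k => mul_nonneg (pow_nonneg hβ0 k) (hle _ _ _).1)
      (fun k => ?_) hgeo
    exact mul_le_of_le_one_right (pow_nonneg hβ0 k) (hle _ _ _).2
  have hsum' : ∀ z, Summable fun k : ℕ => β ^ k * ∑ a', (S ^ (k + 1)) (x, a) (z, a') := by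
    intro z
    simp only [Finset.mul_sum]
    exact summable_sum fun a' _ => hsum (x, a) (z, a')
  set h : X × A → ℝ := fun q => g q.1 with hh
  set u : X × A → ℝ := fun q => U q.1 q.2 with hu
  have hfix : u = (1 - β) • S.mulVec h + β • S.mulVec u := by
    ext ⟨y, b⟩
    simp only [Pi.add_apply, Pi.smul_apply, smul_eq_mul, hS, sam_mulVec]
    simp only [hu, hh, ← Finset.sum_mul, hπ1, one_mul]
    rw [hU, Finset.mul_sum, Finset.mul_sum, ← Finset.sum_add_distrib]
    refine Finset.sum_congr rfl fun x' _ => ?_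
    ring
  have hiter : ∀ K : ℕ, u = (1 - β) • ∑ k ∈ Finset.range K, β ^ k • (S ^ (k + 1)).mulVec h
      + β ^ K • (S ^ K).mulVec u := by
    intro K
    induction K with
    | zero => simp
    | succ K ih =>
      have e : (S ^ K).mulVec u = (1 - β) • (S ^ (K + 1)).mulVec h
          + β • (S ^ (K + 1)).mulVec u := by
        conv_lhs => rw [hfix]
        simp only [Matrix.mulVec_add, Matrix.mulVec_smul, Matrix.mulVec_mulVec, pow_succ]
      rw [Finset.sum_range_succ]
      conv_lhs => rw [ih, e]
      simp only [smul_add, smul_smul, pow_succ, mul_comm]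
      abel
  have hsumh : HasSum (fun k : ℕ => β ^ k * (S ^ (k + 1)).mulVec h (x, a))
      (∑ z, (∑' k : ℕ, β ^ k * ∑ a', (S ^ (k + 1)) (x, a) (z, a')) * g z) := by
    have := hasSum_sum (s := (Finset.univ : Finset X)) fun z _ => ((hsum' z).hasSum.mul_right (g z))
    rw [show (fun k : ℕ => β ^ k * (S ^ (k + 1)).mulVec h (x, a)) = _ from funext fun k => ?_]
    · exact this
    · simp only [Matrix.mulVec, dotProduct, Fintype.sum_prod_type, hh, Finset.mul_sum,
        Finset.sum_mul, mul_assoc]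
  have ht1 := hsumh.tendsto_sum_nat.const_mul (1 - β)
  have ht2 : Filter.Tendsto (fun K : ℕ => β ^ K * (S ^ K).mulVec u (x, a)) Filter.atTop
      (nhds 0) := by
    refine squeeze_zero_norm (a := fun K : ℕ => β ^ K * ∑ q, |u q|) (fun K => ?_) ?_
    · rw [norm_mul, Real.norm_of_nonneg (pow_nonneg hβ0 K)]
      refine mul_le_mul_of_nonneg_left ?_ (pow_nonneg hβ0 K)
      refine (norm_sum_le _ _).trans (Finset.sum_le_sum fun q _ => ?_)
      rw [norm_mul, Real.norm_of_nonneg (hle _ _ _).1]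
      exact mul_le_of_le_one_left (abs_nonneg _) (hle _ _ _).2
    · simpa using (tendsto_pow_atTop_nhds_zero_of_lt_one hβ0 hβ1).mul_const (∑ q, |u q|)
  have ht := ht1.add ht2
  have hc : (fun K : ℕ => (1 - β) * ∑ k ∈ Finset.range K, β ^ k * (S ^ (k + 1)).mulVec h (x, a)
      + β ^ K * (S ^ K).mulVec u (x, a)) = fun _ => U x a := by
    funext K
    have := congrFun (hiter K) (x, a)
    simp only [Pi.add_apply, Pi.smul_apply, smul_eq_mul, Finset.sum_apply] at this
    exact this.symm
  rw [hc] at ht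
  have := tendsto_nhds_unique tendsto_const_nhds ht
  rw [this, add_zero, Finset.mul_sum]
  refine Finset.sum_congr rfl fun z _ => ?_
  rw [visit, mul_assoc]

theorem marginal_succ_sum {X A : Type} [Fintype X] [Fintype A] [DecidableEq X] [DecidableEq A]
    (P : X → A → X → ℝ) (β : ℝ) (πs : ℕ → X → A → ℝ) (x : X) (a : A) (m : ℕ)
    (f : X × A → ℝ) :
    ∑ q, marginal P β πs x a (m + 1) q * f q =
      ∑ p, marginal P β πs x a m p *
        ∑ z, visit P (πs m) β p.1 p.2 z * ∑ b, πs (m + 1) z b * f (z, b) := by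
  simp only [marginal, Finset.sum_mul]
  rw [Finset.sum_comm]
  refine Finset.sum_congr rfl fun p _ => ?_
  simp only [Fintype.sum_prod_type, Finset.mul_sum, mul_assoc]

/-- **Evaluation of geometric switching policies via composed geometric horizon models
(general rewards).**  For a finite MDP with discount `γ ∈ (0,1)` and reward
`r : X × A → ℝ`, switching probability `α ∈ (0,1]`, `β = γ(1-α)`, and the geometric
switching policy `ν = π₁ →α ⋯ →α πₙ` (policies `πs 0, …, πs (n-1)`, with Q-functions
`Qs m` of the suffix GSPs characterised by the recursive fixed-point equations),
`Qs 0 x a = Q^ν_γ(x,a)` equals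
`r(x,a) + γ/(1-γ) [ ∑_{m=1}^{n-1} ((1-γ)/(1-β)) ((γ-β)/(1-β))^{m-1}
    E[(1-α) r^{π_m}(X^{(m)}) + α r^{π_{m+1}}(X^{(m)})]
  + ((γ-β)/(1-β))^{n-1} E[r^{πₙ}(X')] ]`. -/
theorem gsp_evaluation_general_rewards
    {X A : Type} [Fintype X] [Fintype A] [DecidableEq X] [DecidableEq A]
    [Nonempty X] [Nonempty A]
    (P : X → A → X → ℝ) (hP0 : ∀ x a x', 0 ≤ P x a x')
    (hP1 : ∀ x a, ∑ x', P x a x' = 1)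
    (r : X → A → ℝ) (γ α : ℝ) (hγ0 : 0 < γ) (hγ1 : γ < 1) (hα0 : 0 < α) (hα1 : α ≤ 1)
    (β : ℝ) (hβ : β = γ * (1 - α))
    (n : ℕ) (hn : 1 ≤ n)
    (πs : ℕ → X → A → ℝ)
    (hπ0 : ∀ m x a, 0 ≤ πs m x a) (hπ1 : ∀ m x, ∑ a, πs m x a = 1)
    (Qs : ℕ → X → A → ℝ)
    (hQlast : ∀ x a, Qs (n - 1) x a =
      r x a + γ * ∑ x', P x a x' * ∑ a', πs (n - 1) x' a' * Qs (n - 1) x' a')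
    (hQstep : ∀ m, m + 1 < n → ∀ x a, Qs m x a =
      r x a + γ * ∑ x', P x a x' *
        ((1 - α) * ∑ a', πs m x' a' * Qs m x' a'
          + α * ∑ a', πs (m + 1) x' a' * Qs (m + 1) x' a'))
    (x : X) (a : A) :
    Qs 0 x a = r x a + γ / (1 - γ) *
      ((∑ m ∈ Finset.range (n - 1),
          (1 - γ) / (1 - β) * ((γ - β) / (1 - β)) ^ m *
            ∑ q : X × A, marginal P β πs x a (m + 1) q *
              ((1 - α) * rewardUnder r (πs m) q.1 + α * rewardUnder r (πs (m + 1)) q.1))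
        + ((γ - β) / (1 - β)) ^ (n - 1) *
          ∑ p : X × A, marginal P β πs x a (n - 1) p *
            ∑ z, visit P (πs (n - 1)) γ p.1 p.2 z * rewardUnder r (πs (n - 1)) z) := by
  have hβ0 : 0 ≤ β := by rw [hβ]; exact mul_nonneg hγ0.le (by linarith)
  have hβ1 : β < 1 := by rw [hβ]; nlinarith
  have h1β : (1 - β) ≠ 0 := by linarith
  have h1γ : (1 - γ) ≠ 0 := by linarith
  have hγne : γ ≠ 0 := hγ0.ne'
  have hgb : γ - β = γ * α := by rw [hβ]; ring
  have key : ∀ (δ : ℝ) (_ : 0 ≤ δ) (_ : δ < 1) (g : X → ℝ) (m : ℕ)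
      (_ : ∀ x a, Qs m x a - r x a = γ * ∑ x', P x a x' *
        (g x' + δ / γ * ∑ a', πs m x' a' * (Qs m x' a' - r x' a'))) (x : X) (a : A),
      Qs m x a - r x a = γ / (1 - δ) * ∑ z, visit P (πs m) δ x a z * g z := by
    intro δ hδ0 hδ1 g m hm x a
    have h1δ : (1 - δ) ≠ 0 := by linarith
    have := visit_eq P hP0 hP1 (πs m) (hπ0 m) (hπ1 m) δ hδ0 hδ1 g
      (fun x a => (1 - δ) / γ * (Qs m x a - r x a)) (fun x a => ?_) x a
    · rw [← this]; field_simp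
    · show (1 - δ) / γ * (Qs m x a - r x a) = _
      rw [hm, ← mul_assoc, div_mul_cancel₀ _ hγne, Finset.mul_sum]
      refine Finset.sum_congr rfl fun x' _ => ?_
      have e : ∑ a', πs m x' a' * ((1 - δ) / γ * (Qs m x' a' - r x' a'))
          = (1 - δ) / γ * ∑ a', πs m x' a' * (Qs m x' a' - r x' a') := by
        rw [Finset.mul_sum]
        exact Finset.sum_congr rfl fun _ _ => by ring
      rw [e]; ring
  have split : ∀ m k y, ∑ b, πs m y b * (Qs k y b - r y b)
      = ∑ b, πs m y b * Qs k y b - rewardUnder r (πs m) y := by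
    intro m k y
    simp only [rewardUnder, mul_sub, Finset.sum_sub_distrib]
  have hlast : ∀ x a, Qs (n - 1) x a - r x a = γ / (1 - γ) *
      ∑ z, visit P (πs (n - 1)) γ x a z * rewardUnder r (πs (n - 1)) z := by
    refine key γ hγ0.le hγ1 _ (n - 1) fun x a => ?_
    simp only [split, div_self hγne, one_mul, add_sub_cancel]
    linarith [hQlast x a]
  have hstep : ∀ m, m + 1 < n → ∀ x a, Qs m x a - r x a = γ / (1 - β) *
      ∑ z, visit P (πs m) β x a z * (((1 - α) * rewardUnder r (πs m) z
        + α * rewardUnder r (πs (m + 1)) z)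
        + α * ∑ b, πs (m + 1) z b * (Qs (m + 1) z b - r z b)) := by
    intro m hm
    refine key β hβ0 hβ1 _ m fun x a => ?_
    have hd : β / γ = 1 - α := by rw [hβ]; field_simp
    rw [hQstep m hm x a, hd, add_sub_cancel_left]
    congr 1
    refine Finset.sum_congr rfl fun x' _ => ?_
    rw [split, split]; ring
  have main : ∀ k, k ≤ n - 1 → Qs 0 x a - r x a =
      γ / (1 - γ) * (∑ m ∈ Finset.range k,
          (1 - γ) / (1 - β) * ((γ - β) / (1 - β)) ^ m *
            ∑ q : X × A, marginal P β πs x a (m + 1) q *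
              ((1 - α) * rewardUnder r (πs m) q.1 + α * rewardUnder r (πs (m + 1)) q.1))
        + ((γ - β) / (1 - β)) ^ k *
          ∑ p : X × A, marginal P β πs x a k p * (Qs k p.1 p.2 - r p.1 p.2) := by
    intro k
    induction k with
    | zero => intro _; simp [marginal]
    | succ k ih =>
      intro hk
      have e : ∑ p : X × A, marginal P β πs x a k p * (Qs k p.1 p.2 - r p.1 p.2)
          = γ / (1 - β) * ∑ q : X × A, marginal P β πs x a (k + 1) q *
              ((1 - α) * rewardUnder r (πs k) q.1 + α * rewardUnder r (πs (k + 1)) q.1)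
            + (γ - β) / (1 - β) * ∑ q : X × A, marginal P β πs x a (k + 1) q *
              (Qs (k + 1) q.1 q.2 - r q.1 q.2) := by
        rw [marginal_succ_sum, marginal_succ_sum, Finset.mul_sum, Finset.mul_sum,
          ← Finset.sum_add_distrib]
        refine Finset.sum_congr rfl fun p _ => ?_
        rw [hstep k (by omega)]
        simp only [← Finset.sum_mul, hπ1, one_mul]
        simp only [mul_add (visit _ _ _ _ _ _), mul_left_comm (visit _ _ _ _ _ _) α,
          Finset.sum_add_distrib, ← Finset.mul_sum, hgb]
        ring
      rw [ih (by omega), Finset.sum_range_succ, e, pow_succ]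
      field_simp
      ring
  have hfin := main (n - 1) le_rfl
  have e : ∑ p : X × A, marginal P β πs x a (n - 1) p * (Qs (n - 1) p.1 p.2 - r p.1 p.2)
      = γ / (1 - γ) * ∑ p : X × A, marginal P β πs x a (n - 1) p *
            ∑ z, visit P (πs (n - 1)) γ p.1 p.2 z * rewardUnder r (πs (n - 1)) z := by
    rw [Finset.mul_sum]
    refine Finset.sum_congr rfl fun p _ => ?_
    rw [hlast]; ring
  rw [e] at hfin
  rw [mul_add]
  linarith
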